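/- arXiv:1411.7132 — 2 statements merged into one kernel-verified Lean document; each statement's English description precedes it below -/
import Mathlib

section
/- For every test function ψ ∈ C_c^∞(ℝ³) one has ∫_{ℝ³} (∂₃²ψ)(x) / |x|_{1/F}² dx = lim_{ε→0⁺} ∫_{{|y| ≥ ε}} K₀(y) (ψ(y) − ψ(0)) dy; in particular the limit on the right-hand side exists. (This identifies, up to the factor C/F, the distributional second derivative ∂₃² of the locally integrable function x ↦ 1/|x|_{1/F}² with the principal-value-type singular integral against the kernel K₀.) -/
open MeasureTheory Filter
open scoped Real Topology

noncomputable section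

/-- `|x|_{1/F}² = x₁² + x₂² + x₃²/F²`. -/
def normInvFsq (F : ℝ) (x : EuclideanSpace ℝ (Fin 3)) : ℝ :=
  x 0 ^ 2 + x 1 ^ 2 + x 2 ^ 2 / F ^ 2

/-- The kernel `K₀(y) = −(2/F²)(y₁² + y₂² − 3y₃²/F²)/|y|_{1/F}⁶`, homogeneous of degree −4. -/
def K₀ (F : ℝ) (y : EuclideanSpace ℝ (Fin 3)) : ℝ :=
  -(2 / F ^ 2) * (y 0 ^ 2 + y 1 ^ 2 - 3 * y 2 ^ 2 / F ^ 2) / (normInvFsq F y) ^ 3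

/-- Partial derivative in the third coordinate direction. -/
def d₃ (ψ : EuclideanSpace ℝ (Fin 3) → ℝ) : EuclideanSpace ℝ (Fin 3) → ℝ :=
  fun x => fderiv ℝ ψ x (EuclideanSpace.single 2 1)

theorem integrable_inv_sq_norm_mul_inv_one_add_sq_norm :
    Integrable fun y : EuclideanSpace ℝ (Fin 3) => (‖y‖ ^ 2)⁻¹ * (1 + ‖y‖ ^ 2)⁻¹ := by
  refine (integrable_fun_norm_addHaar volume
    (f := fun r : ℝ => (r ^ 2)⁻¹ * (1 + r ^ 2)⁻¹)).2 ?_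
  refine (integrable_inv_one_add_sq.integrableOn (s := Set.Ioi 0)).congr_fun ?_ measurableSet_Ioi
  intro r hr
  have : r ≠ 0 := ne_of_gt hr
  have h3 : Module.finrank ℝ (EuclideanSpace ℝ (Fin 3)) - 1 = 2 := by simp
  simp only [h3, smul_eq_mul]
  field_simp

theorem sq_norm_eq_sum_three (y : EuclideanSpace ℝ (Fin 3)) :
    ‖y‖ ^ 2 = y 0 ^ 2 + y 1 ^ 2 + y 2 ^ 2 := by
  simp [EuclideanSpace.norm_sq_eq, Fin.sum_univ_three]

theorem le_div_sq_of_mem_Ioc {F : ℝ} (hF : F ∈ Set.Ioc (0 : ℝ) 1) {a : ℝ} (ha : 0 ≤ a) :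
    a ≤ a / F ^ 2 := by
  have h0 := hF.1
  rw [le_div_iff₀ (by positivity)]
  exact mul_le_of_le_one_right ha (pow_le_one₀ h0.le hF.2)

theorem sq_norm_le_normInvFsq {F : ℝ} (hF : F ∈ Set.Ioc (0 : ℝ) 1)
    (y : EuclideanSpace ℝ (Fin 3)) : ‖y‖ ^ 2 ≤ normInvFsq F y := by
  rw [sq_norm_eq_sum_three, normInvFsq]
  gcongr
  exact le_div_sq_of_mem_Ioc hF (sq_nonneg _)

theorem abs_inv_normInvFsq_le {F : ℝ} (hF : F ∈ Set.Ioc (0 : ℝ) 1)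
    (y : EuclideanSpace ℝ (Fin 3)) : |(normInvFsq F y)⁻¹| ≤ (‖y‖ ^ 2)⁻¹ := by
  have h := sq_norm_le_normInvFsq hF y
  rcases eq_or_ne y 0 with rfl | hy
  · simp [normInvFsq]
  have hy' : 0 < ‖y‖ ^ 2 := by positivity
  rw [abs_of_pos (inv_pos.2 (hy'.trans_le h))]
  gcongr

theorem abs_K₀_le {F : ℝ} (hF : F ∈ Set.Ioc (0 : ℝ) 1) (y : EuclideanSpace ℝ (Fin 3)) :
    |K₀ F y| ≤ 6 / F ^ 2 * ((‖y‖ ^ 2)⁻¹ * (‖y‖ ^ 2)⁻¹) := by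
  have h0 := hF.1
  set N := normInvFsq F y with hN
  have hN0 : 0 ≤ N := (sq_nonneg _).trans (sq_norm_le_normInvFsq hF y)
  have hnum : |y 0 ^ 2 + y 1 ^ 2 - 3 * y 2 ^ 2 / F ^ 2| ≤ 3 * N := by
    have h2 : 0 ≤ y 2 ^ 2 / F ^ 2 := by positivity
    rw [mul_div_assoc, hN, normInvFsq, abs_le]
    constructor <;> nlinarith [sq_nonneg (y 0), sq_nonneg (y 1)]
  have hinv : N⁻¹ ≤ (‖y‖ ^ 2)⁻¹ := (le_abs_self _).trans (abs_inv_normInvFsq_le hF y)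
  calc |K₀ F y| = 2 / F ^ 2 * |y 0 ^ 2 + y 1 ^ 2 - 3 * y 2 ^ 2 / F ^ 2| / N ^ 3 := by
        rw [K₀, abs_div, abs_mul, abs_neg, abs_of_pos (by positivity : 0 < 2 / F ^ 2),
          abs_of_nonneg (pow_nonneg hN0 3)]
    _ ≤ 2 / F ^ 2 * (3 * N) / N ^ 3 := by gcongr
    _ = 6 / F ^ 2 * (N⁻¹ * N⁻¹) := by
        rcases eq_or_ne N 0 with h | h
        · simp [h]
        · field_simp; ring
    _ ≤ _ := by gcongr

theorem measurable_normInvFsq (F : ℝ) : Measurable (normInvFsq F) := by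
  unfold normInvFsq
  fun_prop

theorem measurable_K₀ (F : ℝ) : Measurable (K₀ F) := by
  have := measurable_normInvFsq F
  unfold K₀
  fun_prop

theorem integrable_K₀_mul {F : ℝ} (hF : F ∈ Set.Ioc (0 : ℝ) 1)
    {f : EuclideanSpace ℝ (Fin 3) → ℝ} (hf : Measurable f) {C : ℝ}
    (hC : ∀ y, |f y| * (1 + ‖y‖ ^ 2) ≤ C * ‖y‖ ^ 2) : Integrable fun y => K₀ F y * f y := by
  refine (integrable_inv_sq_norm_mul_inv_one_add_sq_norm.const_mul (6 / F ^ 2 * C)).mono'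
    ((measurable_K₀ F).mul hf).aestronglyMeasurable (ae_of_all _ fun y => ?_)
  have h0 := hF.1
  rcases eq_or_ne y 0 with rfl | hy
  · simp [K₀]
  have hy' : 0 < ‖y‖ := by positivity
  rw [Real.norm_eq_abs, abs_mul]
  calc |K₀ F y| * |f y|
      ≤ 6 / F ^ 2 * ((‖y‖ ^ 2)⁻¹ * (‖y‖ ^ 2)⁻¹) * (C * ‖y‖ ^ 2 / (1 + ‖y‖ ^ 2)) := by
        gcongr
        · exact abs_K₀_le hF y
        · rw [le_div_iff₀ (by positivity)]
          exact hC y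
    _ = _ := by field_simp

theorem integrable_div_normInvFsq {F : ℝ} (hF : F ∈ Set.Ioc (0 : ℝ) 1)
    {f : EuclideanSpace ℝ (Fin 3) → ℝ} (hf : Measurable f) {C : ℝ}
    (hC : ∀ y, |f y| * (1 + ‖y‖ ^ 2) ≤ C) : Integrable fun y => f y / normInvFsq F y := by
  refine (integrable_inv_sq_norm_mul_inv_one_add_sq_norm.const_mul C).mono'
    (hf.div (measurable_normInvFsq F)).aestronglyMeasurable (ae_of_all _ fun y => ?_)
  rw [Real.norm_eq_abs, div_eq_mul_inv, abs_mul]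
  calc |f y| * |(normInvFsq F y)⁻¹| ≤ C / (1 + ‖y‖ ^ 2) * (‖y‖ ^ 2)⁻¹ := by
        gcongr
        · exact (abs_nonneg _).trans ((le_div_iff₀ (by positivity)).2 (hC y))
        · exact (le_div_iff₀ (by positivity)).2 (hC y)
        · exact abs_inv_normInvFsq_le hF y
    _ = _ := by ring

theorem normInvFsq_neg (F : ℝ) (y : EuclideanSpace ℝ (Fin 3)) :
    normInvFsq F (-y) = normInvFsq F y := by
  simp [normInvFsq]

theorem K₀_neg (F : ℝ) (y : EuclideanSpace ℝ (Fin 3)) : K₀ F (-y) = K₀ F y := by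
  simp [K₀, normInvFsq_neg]

theorem integral_eq_zero_of_forall_vertical_line {G : EuclideanSpace ℝ (Fin 3) → ℝ}
    (hG : Integrable G)
    (h : ∀ v : Fin 2 → ℝ, v ≠ 0 → Integrable (fun t : ℝ => G !₂[v 0, v 1, t]) →
      ∫ t : ℝ, G !₂[v 0, v 1, t] = 0) :
    ∫ x, G x = 0 := by
  let e := MeasurableEquiv.piFinSuccAbove (fun _ : Fin 3 => ℝ) 2
  have he : MeasurePreserving e.symm :=
    (volume_preserving_piFinSuccAbove (fun _ : Fin 3 => ℝ) 2).symm
  have hL : MeasurePreserving (MeasurableEquiv.toLp 2 (Fin 3 → ℝ)) :=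
    PiLp.volume_preserving_toLp (Fin 3)
  have hcomp := hL.comp he
  have hemb : MeasurableEmbedding (MeasurableEquiv.toLp 2 (Fin 3 → ℝ) ∘ e.symm) :=
    (MeasurableEquiv.toLp 2 (Fin 3 → ℝ)).measurableEmbedding.comp e.symm.measurableEmbedding
  have hpt : ∀ p : ℝ × (Fin 2 → ℝ),
      (MeasurableEquiv.toLp 2 (Fin 3 → ℝ) ∘ e.symm) p = !₂[p.2 0, p.2 1, p.1] := by
    intro p
    ext i
    fin_cases i <;> rfl
  have hint : Integrable (fun p : ℝ × (Fin 2 → ℝ) => G !₂[p.2 0, p.2 1, p.1]) := by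
    simpa only [Function.comp_def, ← hpt] using (hcomp.integrable_comp_emb hemb).2 hG
  rw [← hcomp.integral_comp hemb]
  simp only [hpt]
  rw [Measure.volume_eq_prod] at hint ⊢
  rw [integral_prod_symm _ hint]
  refine integral_eq_zero_of_ae ?_
  have hne : ∀ᵐ v : Fin 2 → ℝ, v ≠ 0 := compl_mem_ae_iff.2 (measure_singleton 0)
  filter_upwards [hne, hint.prod_left_ae] with v hv hi using h v hv hi

theorem hasDerivAt_comp_vertical_line {f : EuclideanSpace ℝ (Fin 3) → ℝ}
    (hf : Differentiable ℝ f) (a b t : ℝ) :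
    HasDerivAt (fun s : ℝ => f !₂[a, b, s]) (d₃ f !₂[a, b, t]) t := by
  have hline : HasDerivAt (fun s : ℝ => !₂[a, b, s])
      (EuclideanSpace.single (2 : Fin 3) (1 : ℝ)) t := by
    have h := ((hasDerivAt_id t).smul_const (EuclideanSpace.single (2 : Fin 3) (1 : ℝ))).const_add
      !₂[a, b, 0]
    convert! h using 1
    · ext s i
      fin_cases i <;> simp
    · simp
  exact (hf _).hasFDerivAt.comp_hasDerivAt t hline

theorem tendsto_inv_add_sq_div_sq_cocompact {F : ℝ} (hF : 0 < F) (a : ℝ) :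
    Tendsto (fun t : ℝ => (a + t ^ 2 / F ^ 2)⁻¹) (cocompact ℝ) (𝓝 0) := by
  refine tendsto_inv_atTop_zero.comp (tendsto_atTop_add_const_left _ _ ?_)
  refine Tendsto.atTop_div_const (by positivity) ?_
  simpa only [Function.comp_def, Real.norm_eq_abs, sq_abs] using
    (tendsto_pow_atTop two_ne_zero).comp (tendsto_norm_cocompact_atTop (E := ℝ))

theorem hasDerivAt_inv_add_sq_div_sq {F a t : ℝ} (hN : a + t ^ 2 / F ^ 2 ≠ 0) :
    HasDerivAt (fun t : ℝ => (a + t ^ 2 / F ^ 2)⁻¹)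
      (-(2 * t / F ^ 2) / (a + t ^ 2 / F ^ 2) ^ 2) t := by
  have h : HasDerivAt (fun t : ℝ => a + t ^ 2 / F ^ 2) (2 * t / F ^ 2) t := by
    simpa using (((hasDerivAt_id t).pow 2).div_const (F ^ 2)).const_add a
  exact h.fun_inv hN

theorem hasDerivAt_deriv_inv_add_sq_div_sq {F a t : ℝ} (hN : a + t ^ 2 / F ^ 2 ≠ 0) :
    HasDerivAt (fun t : ℝ => -(2 * t / F ^ 2) / (a + t ^ 2 / F ^ 2) ^ 2)
      (-(2 / F ^ 2) * (a - 3 * t ^ 2 / F ^ 2) / (a + t ^ 2 / F ^ 2) ^ 3) t := by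
  have h : HasDerivAt (fun t : ℝ => a + t ^ 2 / F ^ 2) (2 * t / F ^ 2) t := by
    simpa using (((hasDerivAt_id t).pow 2).div_const (F ^ 2)).const_add a
  have hnum : HasDerivAt (fun t : ℝ => -(2 * t / F ^ 2)) (-(2 / F ^ 2)) t := by
    simpa using (((hasDerivAt_id t).const_mul 2).div_const (F ^ 2)).fun_neg
  refine (hnum.fun_div (h.fun_pow 2) (pow_ne_zero 2 hN)).congr_deriv ?_
  rw [div_eq_div_iff (pow_ne_zero 2 (pow_ne_zero 2 hN)) (pow_ne_zero 3 hN)]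
  push_cast
  ring

theorem integral_K₀_mul_sub_d₃_d₃_div_eq_zero {F : ℝ} (hF : F ∈ Set.Ioc (0 : ℝ) 1)
    {φ : EuclideanSpace ℝ (Fin 3) → ℝ} (hφ : Differentiable ℝ φ) (hdφ : Differentiable ℝ (d₃ φ))
    {A B : ℝ} (hA : ∀ x, |φ x| ≤ A) (hB : ∀ x, |d₃ φ x| ≤ B)
    (hint : Integrable fun x => K₀ F x * φ x - d₃ (d₃ φ) x / normInvFsq F x) :
    ∫ x, (K₀ F x * φ x - d₃ (d₃ φ) x / normInvFsq F x) = 0 := by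
  refine integral_eq_zero_of_forall_vertical_line hint fun v hv hi => ?_
  have hF0 := hF.1
  set a := v 0 ^ 2 + v 1 ^ 2 with ha
  have ha0 : 0 < a := by
    by_contra! h
    refine hv (funext fun i => ?_)
    fin_cases i <;> simp <;> nlinarith [sq_nonneg (v 0), sq_nonneg (v 1)]
  have hN : ∀ t : ℝ, 0 < a + t ^ 2 / F ^ 2 := fun t => by positivity
  set u : ℝ → ℝ := fun t =>
    -(2 * t / F ^ 2) / (a + t ^ 2 / F ^ 2) ^ 2 * φ !₂[v 0, v 1, t]
      - (a + t ^ 2 / F ^ 2)⁻¹ * d₃ φ !₂[v 0, v 1, t] with hu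
  have hderiv : ∀ t, HasDerivAt u (K₀ F !₂[v 0, v 1, t] * φ !₂[v 0, v 1, t]
      - d₃ (d₃ φ) !₂[v 0, v 1, t] / normInvFsq F !₂[v 0, v 1, t]) t := by
    intro t
    have h := ((hasDerivAt_deriv_inv_add_sq_div_sq (hN t).ne').mul
      (hasDerivAt_comp_vertical_line hφ (v 0) (v 1) t)).sub
      ((hasDerivAt_inv_add_sq_div_sq (hN t).ne').mul
      (hasDerivAt_comp_vertical_line hdφ (v 0) (v 1) t))
    refine h.congr_deriv ?_
    have h1 : normInvFsq F !₂[v 0, v 1, t] = a + t ^ 2 / F ^ 2 := by simp [normInvFsq, ha]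
    have h2 : K₀ F !₂[v 0, v 1, t]
        = -(2 / F ^ 2) * (a - 3 * t ^ 2 / F ^ 2) / (a + t ^ 2 / F ^ 2) ^ 3 := by
      simp [K₀, h1, ha]
    rw [h1, h2]
    ring
  have hlim : Tendsto u (cocompact ℝ) (𝓝 0) := by
    have hw := tendsto_inv_add_sq_div_sq_cocompact hF0 a
    have hbound := (((hw.pow 2).add hw).const_mul (2 / F ^ 2 * A)).add (hw.const_mul B)
    simp only [ne_eq, OfNat.ofNat_ne_zero, not_false_eq_true, zero_pow, add_zero, mul_zero]
      at hbound
    refine squeeze_zero_norm (fun t => ?_) hbound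
    have hNt := hN t
    have ht : |t| ≤ 1 + (a + t ^ 2 / F ^ 2) := by
      have := le_div_sq_of_mem_Ioc hF (sq_nonneg t)
      rw [abs_le]
      constructor <;> nlinarith [sq_nonneg (t - 1), sq_nonneg (t + 1)]
    set N := a + t ^ 2 / F ^ 2
    have hfrac : |-(2 * t / F ^ 2) / N ^ 2| ≤ 2 / F ^ 2 * (N⁻¹ ^ 2 + N⁻¹) := by
      rw [abs_div, abs_neg, abs_div, abs_mul, abs_of_pos (by positivity : 0 < F ^ 2),
        abs_of_pos (by positivity : 0 < N ^ 2), abs_two]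
      calc 2 * |t| / F ^ 2 / N ^ 2 ≤ 2 * (1 + N) / F ^ 2 / N ^ 2 := by gcongr
        _ = _ := by field_simp
    calc ‖u t‖ ≤ |-(2 * t / F ^ 2) / N ^ 2 * φ !₂[v 0, v 1, t]|
          + |N⁻¹ * d₃ φ !₂[v 0, v 1, t]| := abs_sub _ _
      _ ≤ 2 / F ^ 2 * (N⁻¹ ^ 2 + N⁻¹) * A + N⁻¹ * B := by
          rw [abs_mul, abs_mul, abs_of_pos (inv_pos.2 hNt)]
          gcongr
          · exact hA _
          · exact hB _
      _ = _ := by ring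
  simpa using integral_of_hasDerivAt_of_tendsto hderiv hi
    (hlim.mono_left atBot_le_cocompact) (hlim.mono_left atTop_le_cocompact)

theorem contDiff_d₃ {f : EuclideanSpace ℝ (Fin 3) → ℝ} (hf : ContDiff ℝ (⊤ : ℕ∞) f) :
    ContDiff ℝ (⊤ : ℕ∞) (d₃ f) :=
  (hf.fderiv_right (m := (⊤ : ℕ∞)) (by simp)).clm_apply contDiff_const

theorem hasCompactSupport_d₃ {f : EuclideanSpace ℝ (Fin 3) → ℝ} (hf : HasCompactSupport f) :
    HasCompactSupport (d₃ f) :=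
  hf.fderiv_apply ℝ _

/-- The even part of `ψ - ψ 0`. -/
def evenPartSub (ψ : EuclideanSpace ℝ (Fin 3) → ℝ) : EuclideanSpace ℝ (Fin 3) → ℝ :=
  fun y => (1 / 2 : ℝ) * (ψ y + ψ (-y)) - ψ 0

theorem hasFDerivAt_comp_neg_right {f : EuclideanSpace ℝ (Fin 3) → ℝ} (hf : Differentiable ℝ f)
    (y : EuclideanSpace ℝ (Fin 3)) : HasFDerivAt (fun z => f (-z)) (-fderiv ℝ f (-y)) y := by
  have h := (hf (-y)).hasFDerivAt.comp y (hasFDerivAt_id y).neg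
  simpa using! h

theorem hasFDerivAt_evenPartSub {ψ : EuclideanSpace ℝ (Fin 3) → ℝ} (hψ : Differentiable ℝ ψ)
    (y : EuclideanSpace ℝ (Fin 3)) :
    HasFDerivAt (evenPartSub ψ) ((1 / 2 : ℝ) • (fderiv ℝ ψ y - fderiv ℝ ψ (-y))) y := by
  rw [sub_eq_add_neg]
  exact
    (((hψ y).hasFDerivAt.fun_add (hasFDerivAt_comp_neg_right hψ y)).const_mul (1 / 2 : ℝ)).sub_const
      (ψ 0)

theorem d₃_evenPartSub {ψ : EuclideanSpace ℝ (Fin 3) → ℝ} (hψ : Differentiable ℝ ψ) :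
    d₃ (evenPartSub ψ) = fun y => (1 / 2 : ℝ) * (d₃ ψ y - d₃ ψ (-y)) := by
  ext y
  simp [d₃, (hasFDerivAt_evenPartSub hψ y).fderiv]

theorem d₃_d₃_evenPartSub {ψ : EuclideanSpace ℝ (Fin 3) → ℝ} (hψ : Differentiable ℝ ψ)
    (hdψ : Differentiable ℝ (d₃ ψ)) :
    d₃ (d₃ (evenPartSub ψ)) = fun y => (1 / 2 : ℝ) * (d₃ (d₃ ψ) y + d₃ (d₃ ψ) (-y)) := by
  ext y
  have h := ((hdψ y).hasFDerivAt.fun_sub (hasFDerivAt_comp_neg_right hdψ y)).const_mul (1 / 2 : ℝ)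
  rw [d₃_evenPartSub hψ, d₃, h.fderiv]
  simp [d₃, mul_add]

theorem exists_abs_evenPartSub_le_mul_sq_norm {ψ : EuclideanSpace ℝ (Fin 3) → ℝ}
    (hψ : ContDiff ℝ (⊤ : ℕ∞) ψ) (hψc : HasCompactSupport ψ) :
    ∃ C : ℝ, ∀ y, |evenPartSub ψ y| ≤ C * ‖y‖ ^ 2 := by
  obtain ⟨L, hL⟩ := ContDiff.lipschitzWith_of_hasCompactSupport (𝕂 := ℝ) (hψc.fderiv ℝ)
    (hψ.fderiv_right (m := (⊤ : ℕ∞)) (by simp)) (by simp)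
  have hd : Differentiable ℝ ψ := hψ.differentiable (by simp)
  refine ⟨L, fun y => ?_⟩
  have hbound : ∀ x ∈ Metric.closedBall (0 : EuclideanSpace ℝ (Fin 3)) ‖y‖,
      ‖fderiv ℝ (evenPartSub ψ) x‖ ≤ L * ‖y‖ := by
    intro x hx
    have hx' : ‖x‖ ≤ ‖y‖ := by simpa using hx
    rw [(hasFDerivAt_evenPartSub hd x).fderiv, norm_smul]
    have h1 := hL.norm_sub_le x (-x)
    have h2 : ‖x - -x‖ = 2 * ‖x‖ := by rw [sub_neg_eq_add, ← two_smul ℝ x, norm_smul]; simp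
    rw [h2] at h1
    calc ‖(1 / 2 : ℝ)‖ * ‖fderiv ℝ ψ x - fderiv ℝ ψ (-x)‖ ≤ 1 / 2 * (L * (2 * ‖x‖)) := by
          gcongr
          simp
      _ = L * ‖x‖ := by ring
      _ ≤ L * ‖y‖ := by gcongr
  have h := Convex.norm_image_sub_le_of_norm_fderiv_le
    (fun x _ => (hasFDerivAt_evenPartSub hd x).differentiableAt) hbound
    (convex_closedBall 0 ‖y‖) (x := 0) (y := y) (by simp) (by simp)
  have h0 : evenPartSub ψ 0 = 0 := by simp [evenPartSub]; ring
  rw [h0, sub_zero, sub_zero, Real.norm_eq_abs] at h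
  linarith

theorem integral_div_normInvFsq_evenPart (F : ℝ) {g : EuclideanSpace ℝ (Fin 3) → ℝ}
    (hg : Integrable fun x => g x / normInvFsq F x) :
    ∫ x, (1 / 2 : ℝ) * (g x + g (-x)) / normInvFsq F x = ∫ x, g x / normInvFsq F x := by
  have hneg : Integrable fun x => g (-x) / normInvFsq F x := by
    simpa only [normInvFsq_neg] using hg.comp_neg
  have heq : ∫ x, g (-x) / normInvFsq F x = ∫ x, g x / normInvFsq F x := by
    simpa only [normInvFsq_neg] using integral_neg_eq_self (fun x => g x / normInvFsq F x) volume
  calc ∫ x, (1 / 2 : ℝ) * (g x + g (-x)) / normInvFsq F x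
      = ∫ x, (1 / 2 : ℝ) * (g x / normInvFsq F x + g (-x) / normInvFsq F x) := by
        congr with x
        ring
    _ = _ := by
        rw [integral_const_mul, integral_add hg hneg, heq]
        ring

theorem setIntegral_K₀_mul_sub_eq_evenPartSub {F : ℝ} (hF : F ∈ Set.Ioc (0 : ℝ) 1)
    {ψ : EuclideanSpace ℝ (Fin 3) → ℝ} (hψ : Continuous ψ) {M : ℝ} (hM : ∀ x, |ψ x| ≤ M)
    {ε : ℝ} (hε : 0 < ε) :
    ∫ y in {y : EuclideanSpace ℝ (Fin 3) | ε ≤ ‖y‖}, K₀ F y * (ψ y - ψ 0)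
      = ∫ y in {y : EuclideanSpace ℝ (Fin 3) | ε ≤ ‖y‖}, K₀ F y * evenPartSub ψ y := by
  set S := {y : EuclideanSpace ℝ (Fin 3) | ε ≤ ‖y‖} with hS
  have hSm : MeasurableSet S := measurableSet_le measurable_const measurable_norm
  simp only [← integral_indicator hSm]
  have hM0 : 0 ≤ M := (abs_nonneg _).trans (hM 0)
  set f : EuclideanSpace ℝ (Fin 3) → ℝ := S.indicator fun y => ψ y - ψ 0 with hf
  have hfm : Measurable f := (hψ.measurable.sub_const _).indicator hSm
  have hint : Integrable fun y => K₀ F y * f y := by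
    refine integrable_K₀_mul hF hfm (C := 2 * M * ((ε ^ 2)⁻¹ + 1)) fun y => ?_
    by_cases hy : y ∈ S
    · have hy' : ε ^ 2 ≤ ‖y‖ ^ 2 := pow_le_pow_left₀ hε.le hy 2
      rw [hf, Set.indicator_of_mem hy, mul_assoc]
      gcongr
      · exact (abs_sub _ _).trans (by linarith [hM y, hM 0])
      · have : 1 ≤ (ε ^ 2)⁻¹ * ‖y‖ ^ 2 := by
          rw [inv_mul_eq_div, one_le_div (by positivity)]
          exact hy'
        linarith
    · rw [hf, Set.indicator_of_notMem hy]
      simp only [abs_zero, zero_mul]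
      positivity
  have hneg : Integrable fun y => K₀ F y * f (-y) := by
    simpa only [K₀_neg] using hint.comp_neg
  have heq : ∫ y, K₀ F y * f (-y) = ∫ y, K₀ F y * f y := by
    simpa only [K₀_neg] using integral_neg_eq_self (fun y => K₀ F y * f y) volume
  calc ∫ y, S.indicator (fun y => K₀ F y * (ψ y - ψ 0)) y
      = ∫ y, K₀ F y * f y := by
        simp only [hf, Set.indicator_mul_right]
    _ = ∫ y, (1 / 2 : ℝ) * (K₀ F y * f y + K₀ F y * f (-y)) := by
        rw [integral_const_mul, integral_add hint hneg, heq]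
        ring
    _ = ∫ y, S.indicator (fun y => K₀ F y * evenPartSub ψ y) y := by
        congr with y
        have hy : -y ∈ S ↔ y ∈ S := by simp [hS]
        by_cases h : y ∈ S
        · simp only [hf, Set.indicator_of_mem h, Set.indicator_of_mem (hy.2 h), evenPartSub]
          ring
        · simp [hf, Set.indicator_of_notMem h, Set.indicator_of_notMem (mt hy.1 h)]

theorem tendsto_setIntegral_le_norm {f : EuclideanSpace ℝ (Fin 3) → ℝ} (hf : Integrable f) :
    Tendsto (fun ε : ℝ => ∫ y in {y : EuclideanSpace ℝ (Fin 3) | ε ≤ ‖y‖}, f y)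
      (𝓝[>] 0) (𝓝 (∫ y, f y)) := by
  have hSm : ∀ ε : ℝ, MeasurableSet {y : EuclideanSpace ℝ (Fin 3) | ε ≤ ‖y‖} := fun ε =>
    measurableSet_le measurable_const measurable_norm
  simp only [← integral_indicator (hSm _)]
  refine tendsto_integral_filter_of_dominated_convergence (fun y => ‖f y‖)
    (Eventually.of_forall fun ε => (hf.indicator (hSm ε)).aestronglyMeasurable)
    (Eventually.of_forall fun ε => ae_of_all _ fun y => norm_indicator_le_norm_self _ _)
    hf.norm ?_
  have hne : ∀ᵐ y : EuclideanSpace ℝ (Fin 3), y ≠ 0 := compl_mem_ae_iff.2 (measure_singleton 0)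
  filter_upwards [hne] with y hy
  refine tendsto_const_nhds.congr' ?_
  filter_upwards [nhdsWithin_le_nhds (eventually_le_nhds (norm_pos_iff.2 hy))] with ε hε
  exact (Set.indicator_of_mem (s := {y : EuclideanSpace ℝ (Fin 3) | ε ≤ ‖y‖}) hε f).symm

/-- For every `ψ ∈ C_c^∞(ℝ³)`,
`∫ (∂₃²ψ)(x)/|x|_{1/F}² dx = lim_{ε→0⁺} ∫_{|y|≥ε} K₀(y)(ψ(y) − ψ(0)) dy`;
in particular the limit on the right-hand side exists. -/
theorem distributional_d33_of_inv_normF_sq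
    (F : ℝ) (hF : F ∈ Set.Ioc (0 : ℝ) 1)
    (ψ : EuclideanSpace ℝ (Fin 3) → ℝ)
    (hψ : ContDiff ℝ (⊤ : ℕ∞) ψ) (hψc : HasCompactSupport ψ) :
    Tendsto (fun ε : ℝ =>
        ∫ y in {y : EuclideanSpace ℝ (Fin 3) | ε ≤ ‖y‖}, K₀ F y * (ψ y - ψ 0))
      (𝓝[>] 0)
      (𝓝 (∫ x : EuclideanSpace ℝ (Fin 3), d₃ (d₃ ψ) x / normInvFsq F x)) := by
  have hd : Differentiable ℝ ψ := hψ.differentiable (by simp)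
  have hψ₁ := contDiff_d₃ hψ
  have hd₁ : Differentiable ℝ (d₃ ψ) := hψ₁.differentiable (by simp)
  have hψ₂ := contDiff_d₃ hψ₁
  have hψc₁ := hasCompactSupport_d₃ hψc
  obtain ⟨M, hM⟩ := hψc.exists_bound_of_continuous hψ.continuous
  obtain ⟨M₁, hM₁⟩ := hψc₁.exists_bound_of_continuous hψ₁.continuous
  obtain ⟨M₂, hM₂⟩ := ((hasCompactSupport_d₃ hψc₁).mul_right
    (f' := fun y => 1 + ‖y‖ ^ 2)).exists_bound_of_continuous
    (hψ₂.continuous.mul (by fun_prop))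
  obtain ⟨C, hC⟩ := exists_abs_evenPartSub_le_mul_sq_norm hψ hψc
  simp only [Real.norm_eq_abs] at hM hM₁
  have hA : ∀ y, |evenPartSub ψ y| ≤ 2 * M := fun y => by
    have h := abs_le.1 (hM y)
    have h' := abs_le.1 (hM (-y))
    have h0 := abs_le.1 (hM 0)
    rw [evenPartSub, abs_le]
    constructor <;> linarith
  have hB : ∀ y, |d₃ (evenPartSub ψ) y| ≤ M₁ := fun y => by
    have h := abs_le.1 (hM₁ y)
    have h' := abs_le.1 (hM₁ (-y))
    rw [d₃_evenPartSub hd, abs_le]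
    constructor <;> linarith
  have hφ : Differentiable ℝ (evenPartSub ψ) := fun y =>
    (hasFDerivAt_evenPartSub hd y).differentiableAt
  have hφ₁ : Differentiable ℝ (d₃ (evenPartSub ψ)) := by
    rw [d₃_evenPartSub hd]
    exact (hd₁.sub (hd₁.comp differentiable_id.neg)).const_mul _
  have hK : Integrable fun y => K₀ F y * evenPartSub ψ y :=
    integrable_K₀_mul hF hφ.continuous.measurable (C := 2 * M + C) fun y => by
      nlinarith [hA y, hC y, sq_nonneg ‖y‖]
  have hψ₂i : Integrable fun x => d₃ (d₃ ψ) x / normInvFsq F x :=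
    integrable_div_normInvFsq hF hψ₂.continuous.measurable (C := M₂) fun y => by
      have h := hM₂ y
      rwa [Pi.mul_apply, Real.norm_eq_abs, abs_mul,
        abs_of_pos (by positivity : 0 < 1 + ‖y‖ ^ 2)] at h
  have hφ₂i : Integrable fun x => d₃ (d₃ (evenPartSub ψ)) x / normInvFsq F x := by
    have hneg : Integrable fun x => d₃ (d₃ ψ) (-x) / normInvFsq F x := by
      simpa only [normInvFsq_neg] using hψ₂i.comp_neg
    refine ((hψ₂i.add hneg).const_mul (1 / 2 : ℝ)).congr (ae_of_all _ fun x => ?_)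
    simp only [d₃_d₃_evenPartSub hd hd₁, Pi.add_apply]
    ring
  have hzero := integral_K₀_mul_sub_d₃_d₃_div_eq_zero hF hφ hφ₁ hA hB (hK.sub hφ₂i)
  rw [integral_sub hK hφ₂i, sub_eq_zero, d₃_d₃_evenPartSub hd hd₁,
    integral_div_normInvFsq_evenPart F hψ₂i] at hzero
  rw [← hzero]
  refine (tendsto_setIntegral_le_norm hK).congr' ?_
  filter_upwards [self_mem_nhdsWithin] with ε hε
  exact (setIntegral_K₀_mul_sub_eq_evenPartSub hF hψ.continuous hM hε).symm
end
end

section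
/- There exists a constant C_F > 0 depending only on F such that for every p ∈ [1,∞] and every Schwartz function f on ℝ³, ‖Λf‖_{L^p(ℝ³)} ≤ C_F ∫_{ℝ³} |y|^{-4} ‖f(·−y) + f(·+y) − 2f(·)‖_{L^p(ℝ³)} dy. (The right-hand side is, up to equivalence of norms, the homogeneous Besov norm ‖f‖_{Ḃ¹_{p,1}}; thus ‖Λf‖_{L^p} ≤ C_F ‖f‖_{Ḃ¹_{p,1}}.) -/
open MeasureTheory
open scoped Real ENNReal FourierTransform SchwartzMap

noncomputable section

/-- `|ξ|_F² = ξ₁² + ξ₂² + F²ξ₃²`. -/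
def normFsq (F : ℝ) (ξ : EuclideanSpace ℝ (Fin 3)) : ℝ :=
  ξ 0 ^ 2 + ξ 1 ^ 2 + F ^ 2 * ξ 2 ^ 2

/-- The operator `Λ = ∂₃²(−Δ_F)^{−1/2}`: the Fourier multiplier with symbol `−ξ₃²/|ξ|_F`. -/
def Lambda (F : ℝ) (f : EuclideanSpace ℝ (Fin 3) → ℂ) :
    EuclideanSpace ℝ (Fin 3) → ℂ :=
  fun x => 𝓕⁻ (fun ξ => ((-(ξ 2 ^ 2) / Real.sqrt (normFsq F ξ) : ℝ) : ℂ) * 𝓕 f ξ) x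

/-- **Minkowski's integral inequality** for functions with values in `[0, ∞]`. -/
theorem lintegral_rpow_lintegral_le {α β : Type*} [MeasurableSpace α] [MeasurableSpace β]
    {μ : Measure α} {ν : Measure β} [SFinite μ] [SFinite ν] {p : ℝ} (hp : 1 ≤ p)
    {h : α → β → ℝ≥0∞} (hh : Measurable (Function.uncurry h)) :
    (∫⁻ x, (∫⁻ y, h x y ∂ν) ^ p ∂μ) ^ (1 / p) ≤
      ∫⁻ y, (∫⁻ x, h x y ^ p ∂μ) ^ (1 / p) ∂ν := by
  have hp0 : 0 < p := by linarith
  rcases hp.eq_or_lt with rfl | hp1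
  · simpa using (lintegral_lintegral_swap hh.aemeasurable).le
  set N : β → ℝ≥0∞ := fun y => (∫⁻ x, h x y ^ p ∂μ) ^ (1 / p) with hN
  set M : ℝ≥0∞ := ∫⁻ y, N y ∂ν with hM
  change _ ≤ M
  have hNm : Measurable N :=
    (Measurable.lintegral_prod_left' (f := fun z : α × β => h z.1 z.2 ^ p)
      (hh.pow_const p)).pow_const _
  have hNp : ∀ y, N y ^ p = ∫⁻ x, h x y ^ p ∂μ := fun y => by
    rw [hN, ← ENNReal.rpow_mul, one_div_mul_cancel hp0.ne', ENNReal.rpow_one]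
  by_cases hMt : M = ∞
  · simp [hMt]
  have hNt : ∀ᵐ y ∂ν, N y < ∞ := ae_lt_top hNm hMt
  have hzero : ∀ᵐ x ∂μ, ∀ᵐ y ∂ν, N y = 0 → h x y = 0 := by
    have hs : MeasurableSet {z : α × β | N z.2 = 0 → h z.1 z.2 = 0} := by
      have h1 : MeasurableSet {z : α × β | N z.2 = 0} :=
        (hNm.comp measurable_snd) (measurableSet_singleton 0)
      have h2 : MeasurableSet {z : α × β | h z.1 z.2 = 0} := hh (measurableSet_singleton 0)
      exact h1.imp h2
    rw [Measure.ae_ae_comm (p := fun x y => N y = 0 → h x y = 0) hs]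
    refine Filter.Eventually.of_forall fun y => ?_
    by_cases hy : N y = 0
    · have h0 : ∫⁻ x, h x y ^ p ∂μ = 0 := by rw [← hNp, hy, ENNReal.zero_rpow_of_pos hp0]
      rw [lintegral_eq_zero_iff (by fun_prop)] at h0
      filter_upwards [h0] with x hx _
      simpa [ENNReal.rpow_eq_zero_iff, hp0, hp0.le, hp0.not_gt] using hx
    · exact Filter.Eventually.of_forall fun x hx => absurd hx hy
  set q := p.conjExponent with hq
  have hpq : p.HolderConjugate q := Real.HolderConjugate.conjExponent hp1
  have hq0 : 0 < q := hpq.symm.pos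
  have hqp : 1 / q * p = p - 1 := by
    rw [hq, Real.conjExponent]; field_simp
  have key : ∀ᵐ x ∂μ, (∫⁻ y, h x y ∂ν) ^ p ≤
      M ^ (p - 1) * ∫⁻ y, N y ^ (-(p - 1)) * h x y ^ p ∂ν := by
    filter_upwards [hzero] with x hx
    have h1 : ∫⁻ y, h x y ∂ν ≤
        ∫⁻ y, ((fun y => N y ^ (1 / q)) * fun y => N y ^ (-(1 / q)) * h x y) y ∂ν := by
      refine lintegral_mono_ae ?_
      filter_upwards [hx, hNt] with y hy hyt
      by_cases h0 : N y = 0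
      · simp [hy h0]
      · simp only [Pi.mul_apply]
        rw [← mul_assoc, ← ENNReal.rpow_add _ _ h0 hyt.ne]
        simp
    have h2 := ENNReal.lintegral_mul_le_Lp_mul_Lq ν hpq.symm
      (f := fun y => N y ^ (1 / q)) (g := fun y => N y ^ (-(1 / q)) * h x y)
      (by fun_prop) (by fun_prop)
    have h3 : ∀ y, (N y ^ (1 / q)) ^ q = N y := fun y => by
      rw [← ENNReal.rpow_mul, one_div_mul_cancel hq0.ne', ENNReal.rpow_one]
    have h4 : ∀ y, (N y ^ (-(1 / q)) * h x y) ^ p = N y ^ (-(p - 1)) * h x y ^ p := fun y => by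
      rw [ENNReal.mul_rpow_of_nonneg _ _ hp0.le, ← ENNReal.rpow_mul, neg_mul, hqp]
    simp only [h3, h4] at h2
    calc (∫⁻ y, h x y ∂ν) ^ p ≤ _ := ENNReal.rpow_le_rpow (h1.trans h2) hp0.le
      _ = _ := by
        rw [ENNReal.mul_rpow_of_nonneg _ _ hp0.le, ← ENNReal.rpow_mul, ← ENNReal.rpow_mul, hqp,
          one_div_mul_cancel hp0.ne', ENNReal.rpow_one]
  have hmain : ∫⁻ x, (∫⁻ y, h x y ∂ν) ^ p ∂μ ≤ M ^ p := by
    calc ∫⁻ x, (∫⁻ y, h x y ∂ν) ^ p ∂μ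
        ≤ ∫⁻ x, M ^ (p - 1) * ∫⁻ y, N y ^ (-(p - 1)) * h x y ^ p ∂ν ∂μ := lintegral_mono_ae key
      _ = M ^ (p - 1) * ∫⁻ x, ∫⁻ y, N y ^ (-(p - 1)) * h x y ^ p ∂ν ∂μ :=
        lintegral_const_mul' _ _ (by finiteness)
      _ = M ^ (p - 1) * ∫⁻ y, N y ^ (-(p - 1)) * N y ^ p ∂ν := by
        rw [lintegral_lintegral_swap (by fun_prop)]
        congr 1
        refine lintegral_congr fun y => ?_
        rw [lintegral_const_mul _ (by fun_prop), hNp]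
      _ ≤ M ^ (p - 1) * ∫⁻ y, N y ∂ν := by
        gcongr with y
        by_cases h0 : N y = 0
        · simp [h0, hp0]
        by_cases ht : N y = ∞
        · simp [ht]
        rw [← ENNReal.rpow_add _ _ h0 ht]
        simp
      _ = M ^ p := by
        rw [← hM]
        nth_rw 2 [← ENNReal.rpow_one M]
        rw [← ENNReal.rpow_add_of_nonneg _ _ (by linarith) zero_le_one]
        simp
  calc _ ≤ (M ^ p) ^ (1 / p) := ENNReal.rpow_le_rpow hmain (by positivity)
    _ = M := by rw [← ENNReal.rpow_mul, mul_one_div_cancel hp0.ne', ENNReal.rpow_one]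

/-- The scale integral of a Schwartz kernel is bounded by a homogeneous kernel of degree `-4`. -/
theorem SchwartzMap.exists_lintegral_scale_le {V : Type*} [NormedAddCommGroup V] [NormedSpace ℝ V]
    (g : 𝓢(V, ℂ)) :
    ∃ A > (0 : ℝ), ∀ z : V, z ≠ 0 →
      ∫⁻ s in Set.Ioi (0 : ℝ), ENNReal.ofReal ((s ^ 5)⁻¹) * ‖g (s⁻¹ • z)‖ₑ ≤
        ENNReal.ofReal A * ENNReal.ofReal (1 / ‖z‖ ^ 4) := by
  obtain ⟨C₀, hC₀, h₀⟩ := g.decay 0 0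
  obtain ⟨C₁, hC₁, h₁⟩ := g.decay 6 0
  simp only [norm_iteratedFDeriv_zero, pow_zero, one_mul] at h₀ h₁
  have hg : ∀ w : V, ‖g w‖ * (1 + ‖w‖ ^ 2) ^ 3 ≤ 4 * (C₀ + C₁) := fun w => by
    have h2 : (1 + ‖w‖ ^ 2) ^ 3 ≤ 4 * (1 + ‖w‖ ^ 6) := by
      nlinarith [mul_nonneg (by positivity : (0 : ℝ) ≤ 1 + ‖w‖ ^ 2) (sq_nonneg (‖w‖ ^ 2 - 1))]
    nlinarith [h₀ w, h₁ w, norm_nonneg (g w),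
      mul_le_mul_of_nonneg_left h2 (norm_nonneg (g w))]
  set B := 4 * (C₀ + C₁) with hB
  have hB0 : 0 < B := by positivity
  refine ⟨B / 4, by positivity, fun z hz => ?_⟩
  have hr : 0 < ‖z‖ := norm_pos_iff.mpr hz
  set r := ‖z‖ with hrdef
  have hder : ∀ s ∈ Set.Ici (0 : ℝ), HasDerivAt (fun s : ℝ => -(B / 4) * ((s ^ 2 + r ^ 2) ^ 2)⁻¹)
      (B * s / (s ^ 2 + r ^ 2) ^ 3) s := fun s _ => by
    have hne : s ^ 2 + r ^ 2 ≠ 0 := by positivity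
    have h := (((((hasDerivAt_id s).pow 2).add_const (r ^ 2)).pow 2).inv
      (by simpa using hne)).const_mul (-(B / 4))
    refine h.congr_deriv ?_
    simp
    field_simp
    ring
  have hlim : Filter.Tendsto (fun s : ℝ => -(B / 4) * ((s ^ 2 + r ^ 2) ^ 2)⁻¹) Filter.atTop
      (nhds 0) := by
    rw [← mul_zero (-(B / 4))]
    refine Filter.Tendsto.const_mul _ (Filter.Tendsto.inv_tendsto_atTop ?_)
    refine (Filter.tendsto_pow_atTop two_ne_zero).comp ?_
    exact Filter.tendsto_atTop_add_const_right _ _ (Filter.tendsto_pow_atTop two_ne_zero)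
  have hnn : ∀ s ∈ Set.Ioi (0 : ℝ), 0 ≤ B * s / (s ^ 2 + r ^ 2) ^ 3 := fun s hs => by
    have : (0 : ℝ) < s := hs
    positivity
  have hint := integrableOn_Ioi_deriv_of_nonneg' hder hnn hlim
  have hval := integral_Ioi_of_hasDerivAt_of_nonneg' hder hnn hlim
  calc ∫⁻ s in Set.Ioi (0 : ℝ), ENNReal.ofReal ((s ^ 5)⁻¹) * ‖g (s⁻¹ • z)‖ₑ
      ≤ ∫⁻ s in Set.Ioi (0 : ℝ), ENNReal.ofReal (B * s / (s ^ 2 + r ^ 2) ^ 3) := by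
        refine setLIntegral_mono' measurableSet_Ioi fun s hs => ?_
        have hs0 : (0 : ℝ) < s := hs
        rw [← ofReal_norm, ← ENNReal.ofReal_mul (by positivity)]
        refine ENNReal.ofReal_le_ofReal ?_
        have h := hg (s⁻¹ • z)
        rw [norm_smul, Real.norm_of_nonneg (by positivity), ← hrdef] at h
        rw [le_div_iff₀ (by positivity)]
        calc (s ^ 5)⁻¹ * ‖g (s⁻¹ • z)‖ * (s ^ 2 + r ^ 2) ^ 3
            = s * (‖g (s⁻¹ • z)‖ * (1 + (s⁻¹ * r) ^ 2) ^ 3) := by field_simp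
          _ ≤ s * B := by gcongr
          _ = B * s := mul_comm _ _
    _ = ENNReal.ofReal (∫ s in Set.Ioi (0 : ℝ), B * s / (s ^ 2 + r ^ 2) ^ 3) :=
        (ofReal_integral_eq_lintegral_ofReal hint
          ((ae_restrict_iff' measurableSet_Ioi).mpr (Filter.Eventually.of_forall hnn))).symm
    _ ≤ ENNReal.ofReal (B / 4) * ENNReal.ofReal (1 / r ^ 4) := by
        rw [hval, ← ENNReal.ofReal_mul (by positivity)]
        refine ENNReal.ofReal_le_ofReal (le_of_eq ?_)
        field_simp
        ring

/-- Multiplying by a dilated Fourier transform is convolving with a dilated function. -/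
theorem SchwartzMap.fourierInv_fourier_smul_mul_fourier {V : Type*} [NormedAddCommGroup V]
    [InnerProductSpace ℝ V] [FiniteDimensional ℝ V] [MeasurableSpace V] [BorelSpace V]
    (f g : 𝓢(V, ℂ)) (s : ℝ) (x : V) :
    𝓕⁻ (fun ξ => 𝓕 (g : V → ℂ) (s • ξ) * 𝓕 (f : V → ℂ) ξ) x = ∫ y, g y * f (x - s • y) := by
  have hf : Integrable (𝓕 (f : V → ℂ)) := by
    rw [← SchwartzMap.fourier_coe]; exact (𝓕 f).integrable
  have hfi : 𝓕⁻ (𝓕 (f : V → ℂ)) = f := by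
    rw [← SchwartzMap.fourier_coe, ← SchwartzMap.fourierInv_coe, FourierTransform.fourierInv_fourier_eq]
  have hL : Continuous fun p : V × V => (s • innerₗ V) p.1 p.2 := by
    simp only [LinearMap.smul_apply, innerₗ_apply_apply]
    fun_prop
  have hh : Integrable fun ξ => (𝐞 (inner ℝ ξ x) : Circle) • 𝓕 (f : V → ℂ) ξ := by
    refine hf.norm.mono' ?_ (Filter.Eventually.of_forall fun ξ => (Circle.norm_smul _ _).le)
    refine AEStronglyMeasurable.fun_smul ?_ hf.1
    exact Continuous.aestronglyMeasurable (by fun_prop)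
  have h := VectorFourier.integral_fourierIntegral_smul_eq_flip (L := s • innerₗ V)
    (μ := volume) (ν := volume) (e := 𝐞) Real.continuous_fourierChar hL g.integrable hh
  rw [Real.fourierInv_eq]
  convert h using 1
  · refine integral_congr_ae (Filter.Eventually.of_forall fun ξ => ?_)
    have : VectorFourier.fourierIntegral 𝐞 volume (s • innerₗ V) (g : V → ℂ) ξ
        = 𝓕 (g : V → ℂ) (s • ξ) := by
      simp [Real.fourier_eq, VectorFourier.fourierIntegral, inner_smul_right]
    simp only [this, Circle.smul_def, smul_eq_mul]
    ring
  · refine integral_congr_ae (Filter.Eventually.of_forall fun y => ?_)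
    simp only [smul_eq_mul]
    congr 1
    rw [← congrFun hfi (x - s • y), Real.fourierInv_eq, VectorFourier.fourierIntegral]
    refine integral_congr_ae (Filter.Eventually.of_forall fun ξ => ?_)
    simp only [Circle.smul_def, smul_eq_mul, ← mul_assoc, ← Circle.coe_mul, ← AddChar.map_add_eq_mul,
      LinearMap.flip_apply, LinearMap.smul_apply, innerₗ_apply_apply, inner_sub_right,
      inner_smul_right, real_inner_comm y ξ]
    congr 3
    ring

/-- Pairing an even mean-zero function with translates only sees second differences. -/
theorem SchwartzMap.integral_mul_comp_sub_eq_second_difference {V : Type*} [NormedAddCommGroup V]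
    [NormedSpace ℝ V] [FiniteDimensional ℝ V] [MeasureSpace V] [BorelSpace V]
    [(volume : Measure V).IsAddHaarMeasure]
    (f g : 𝓢(V, ℂ)) (heven : ∀ y, g (-y) = g y) (hzero : ∫ y, g y = 0) (s : ℝ) (x : V) :
    ∫ y, g y * f (x - s • y) =
      2⁻¹ * ∫ y, g y * (f (x - s • y) + f (x + s • y) - 2 * f x) := by
  obtain ⟨C, -, hC⟩ := f.decay 0 0
  simp only [norm_iteratedFDeriv_zero, pow_zero, one_mul] at hC
  have hint : ∀ u : V → V, Continuous u → Integrable fun y => g y * f (u y) := fun u hu =>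
    g.integrable.mul_bdd (f.continuous.comp hu).aestronglyMeasurable
      (Filter.Eventually.of_forall fun y => hC (u y))
  have h1 : ∫ y, g y * f (x + s • y) = ∫ y, g y * f (x - s • y) := by
    rw [← integral_neg_eq_self]
    simp [heven, sub_eq_add_neg]
  have i1 := hint (fun y => x - s • y) (by fun_prop)
  have i2 := hint (fun y => x + s • y) (by fun_prop)
  have i3 : Integrable fun y => g y * (2 * f x) := g.integrable.mul_const _
  have h2 : ∫ y, g y * (f (x - s • y) + f (x + s • y) - 2 * f x) =
      (∫ y, g y * f (x - s • y)) + (∫ y, g y * f (x + s • y)) - ∫ y, g y * (2 * f x) := by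
    rw [← integral_add' i1 i2, ← integral_sub (i1.add i2) i3]
    congr 1 with y
    simp only [Pi.add_apply]
    ring
  rw [h2, h1, integral_mul_const, hzero]
  ring

theorem lintegral_mul_comp_smul {V : Type*} [NormedAddCommGroup V]
    [NormedSpace ℝ V] [FiniteDimensional ℝ V] [MeasurableSpace V] [BorelSpace V]
    (μ : Measure V) [μ.IsAddHaarMeasure] {G H : V → ℝ≥0∞} (hG : Measurable G) (hH : Measurable H)
    {s : ℝ} (hs : 0 < s) :
    ∫⁻ y, G y * H (s • y) ∂μ =
      ENNReal.ofReal ((s ^ Module.finrank ℝ V)⁻¹) * ∫⁻ z, G (s⁻¹ • z) * H z ∂μ := by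
  have h := lintegral_map (μ := μ) (f := fun z => G (s⁻¹ • z) * H z) (g := fun y => s • y)
    (by fun_prop) (by fun_prop)
  rw [Measure.map_addHaar_smul μ hs.ne', lintegral_smul_measure, abs_of_pos (by positivity)] at h
  rw [smul_eq_mul] at h
  rw [h]
  simp [smul_smul, hs.ne']

theorem normFsq_smul (F s : ℝ) (ξ : EuclideanSpace ℝ (Fin 3)) :
    normFsq F (s • ξ) = s ^ 2 * normFsq F ξ := by
  simp only [normFsq, PiLp.smul_apply, smul_eq_mul]
  ring

theorem normFsq_nonneg (F : ℝ) (ξ : EuclideanSpace ℝ (Fin 3)) : 0 ≤ normFsq F ξ := by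
  unfold normFsq
  positivity

theorem sq_mul_norm_sq_le_normFsq {F : ℝ} (hF : F ∈ Set.Ioc (0 : ℝ) 1)
    (ξ : EuclideanSpace ℝ (Fin 3)) : F ^ 2 * ‖ξ‖ ^ 2 ≤ normFsq F ξ := by
  have hF2 : F ^ 2 ≤ 1 := pow_le_one₀ hF.1.le hF.2
  rw [EuclideanSpace.real_norm_sq_eq, Fin.sum_univ_three, normFsq]
  nlinarith [sq_nonneg (ξ 0), sq_nonneg (ξ 1)]

theorem sq_apply_two_le_norm_sq (ξ : EuclideanSpace ℝ (Fin 3)) : ξ 2 ^ 2 ≤ ‖ξ‖ ^ 2 := by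
  rw [EuclideanSpace.real_norm_sq_eq, Fin.sum_univ_three]
  nlinarith [sq_nonneg (ξ 0), sq_nonneg (ξ 1)]

/-- A smooth cutoff on the line, equal to `1` on `[-1, 1]` and to `0` outside `(-2, 2)`. -/
def lineCutoff : ContDiffBump (0 : ℝ) where
  rIn := 1
  rOut := 2
  rIn_pos := one_pos
  rIn_lt_rOut := one_lt_two

theorem lineCutoff_eq_zero {t : ℝ} (ht : 2 ≤ t) : lineCutoff t = 0 :=
  lineCutoff.zero_of_le_dist <| by
    rw [Real.dist_eq, sub_zero]
    exact ht.trans (le_abs_self t)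

theorem mul_lineCutoff_le {t : ℝ} (ht : 0 ≤ t) : t * lineCutoff t ≤ 2 := by
  rcases le_total 2 t with h | h
  · simp [lineCutoff_eq_zero h]
  · nlinarith [lineCutoff.nonneg (x := t), lineCutoff.le_one (x := t)]

/-- The localized symbol `ξ₃² χ(|ξ|_F²)`. -/
def cutoffSymbol (F : ℝ) (ξ : EuclideanSpace ℝ (Fin 3)) : ℂ :=
  ((ξ 2 ^ 2 * lineCutoff (normFsq F ξ) : ℝ) : ℂ)

theorem contDiff_cutoffSymbol (F : ℝ) : ContDiff ℝ (⊤ : ℕ∞) (cutoffSymbol F) := by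
  have hN : ContDiff ℝ (⊤ : ℕ∞) (normFsq F) := by
    unfold normFsq
    fun_prop
  exact Complex.ofRealCLM.contDiff.comp
    ((by fun_prop : ContDiff ℝ (⊤ : ℕ∞) fun ξ : EuclideanSpace ℝ (Fin 3) => ξ 2 ^ 2).mul
      (lineCutoff.contDiff.comp hN))

theorem hasCompactSupport_cutoffSymbol {F : ℝ} (hF : F ∈ Set.Ioc (0 : ℝ) 1) :
    HasCompactSupport (cutoffSymbol F) := by
  refine HasCompactSupport.intro (isCompact_closedBall 0 (2 / F)) fun ξ hξ => ?_
  have hF0 := hF.1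
  rw [mem_closedBall_zero_iff, not_le, div_lt_iff₀ hF.1] at hξ
  have h := sq_mul_norm_sq_le_normFsq hF ξ
  have : 2 ≤ normFsq F ξ := by nlinarith
  simp [cutoffSymbol, lineCutoff_eq_zero this]

/-- The scale integral of the cutoff. -/
def cutoffMass : ℝ := ∫ u in Set.Ioi (0 : ℝ), lineCutoff (u ^ 2)

theorem continuous_lineCutoff_sq : Continuous fun u : ℝ => lineCutoff (u ^ 2) :=
  lineCutoff.continuous.comp (by fun_prop)

theorem integrable_lineCutoff_sq : Integrable fun u : ℝ => lineCutoff (u ^ 2) := by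
  refine continuous_lineCutoff_sq.integrable_of_hasCompactSupport
    (HasCompactSupport.intro (isCompact_closedBall 0 2) fun u hu => lineCutoff_eq_zero ?_)
  rw [mem_closedBall_zero_iff, not_le, Real.norm_eq_abs] at hu
  nlinarith [sq_abs u]

theorem cutoffMass_pos : 0 < cutoffMass := by
  rw [cutoffMass, setIntegral_pos_iff_support_of_nonneg_ae
    (Filter.Eventually.of_forall fun _ => lineCutoff.nonneg) integrable_lineCutoff_sq.integrableOn]
  refine lt_of_lt_of_le ?_ (measure_mono (s := Set.Ioo (0 : ℝ) 1) fun u hu => ⟨?_, hu.1⟩)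
  · simp
  · refine (lineCutoff.pos_of_mem_ball ?_).ne'
    rw [mem_ball_zero_iff, Real.norm_eq_abs, abs_of_nonneg (sq_nonneg u)]
    change u ^ 2 < 2
    nlinarith [hu.1, hu.2]

theorem integral_cutoff_scale {F : ℝ} (hF : F ∈ Set.Ioc (0 : ℝ) 1)
    (ξ : EuclideanSpace ℝ (Fin 3)) :
    ∫ s in Set.Ioi (0 : ℝ), ξ 2 ^ 2 * lineCutoff (s ^ 2 * normFsq F ξ) =
      cutoffMass * (ξ 2 ^ 2 / √(normFsq F ξ)) := by
  rw [integral_const_mul]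
  rcases (normFsq_nonneg F ξ).eq_or_lt with h0 | hpos
  · have h2 : ξ 2 ^ 2 = 0 := by
      have := sq_apply_two_le_norm_sq ξ
      have := sq_mul_norm_sq_le_normFsq hF ξ
      have := pow_pos hF.1 2
      nlinarith [sq_nonneg (ξ 2), sq_nonneg ‖ξ‖]
    simp [h2]
  · have hr : 0 < √(normFsq F ξ) := Real.sqrt_pos.mpr hpos
    have h := integral_comp_mul_left_Ioi (fun u : ℝ => lineCutoff (u ^ 2)) 0 hr
    simp only [mul_pow, Real.sq_sqrt hpos.le, mul_zero, smul_eq_mul] at h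
    simp only [mul_comm _ (normFsq F ξ)]
    rw [h, cutoffMass]
    ring

theorem cutoff_scale_le {F : ℝ} (hF : F ∈ Set.Ioc (0 : ℝ) 1) (s : ℝ)
    (ξ : EuclideanSpace ℝ (Fin 3)) :
    ξ 2 ^ 2 * lineCutoff (s ^ 2 * normFsq F ξ) ≤ (1 + s ^ 2)⁻¹ * (‖ξ‖ ^ 2 + 2 / F ^ 2) := by
  have hF0 := hF.1
  have h1 := sq_apply_two_le_norm_sq ξ
  have h2 := sq_mul_norm_sq_le_normFsq hF ξ
  have h3 := mul_lineCutoff_le (mul_nonneg (sq_nonneg s) (normFsq_nonneg F ξ))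
  set χ := lineCutoff (s ^ 2 * normFsq F ξ) with hχ
  have h0 : 0 ≤ χ := lineCutoff.nonneg
  have h4 : χ ≤ 1 := lineCutoff.le_one
  rw [inv_mul_eq_div, le_div_iff₀ (by positivity)]
  have h5 : ξ 2 ^ 2 * χ ≤ ‖ξ‖ ^ 2 := by nlinarith [sq_nonneg (ξ 2)]
  have h6 : ξ 2 ^ 2 * χ * s ^ 2 ≤ 2 / F ^ 2 := by
    rw [le_div_iff₀ (by positivity)]
    calc ξ 2 ^ 2 * χ * s ^ 2 * F ^ 2 = s ^ 2 * (F ^ 2 * ξ 2 ^ 2) * χ := by ring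
      _ ≤ s ^ 2 * normFsq F ξ * χ := by
        gcongr
        exact (mul_le_mul_of_nonneg_left h1 (sq_nonneg F)).trans h2
      _ ≤ 2 := h3
  linarith

/-- The convolution kernel whose Fourier transform is the localized symbol. -/
def cutoffKernel {F : ℝ} (hF : F ∈ Set.Ioc (0 : ℝ) 1) : 𝓢(EuclideanSpace ℝ (Fin 3), ℂ) :=
  𝓕⁻ ((hasCompactSupport_cutoffSymbol hF).toSchwartzMap (contDiff_cutoffSymbol F))

theorem fourier_cutoffKernel {F : ℝ} (hF : F ∈ Set.Ioc (0 : ℝ) 1) :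
    𝓕 (cutoffKernel hF : EuclideanSpace ℝ (Fin 3) → ℂ) = cutoffSymbol F := by
  rw [← SchwartzMap.fourier_coe, cutoffKernel, FourierTransform.fourier_fourierInv_eq]
  rfl

theorem cutoffKernel_neg {F : ℝ} (hF : F ∈ Set.Ioc (0 : ℝ) 1) (y : EuclideanSpace ℝ (Fin 3)) :
    cutoffKernel hF (-y) = cutoffKernel hF y := by
  have h : ⇑(cutoffKernel hF) = 𝓕⁻ (cutoffSymbol F) := by
    rw [cutoffKernel, SchwartzMap.fourierInv_coe]
    rfl
  have he : (fun ξ => cutoffSymbol F (-ξ)) = cutoffSymbol F := by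
    ext ξ
    simp [cutoffSymbol, normFsq]
  rw [h, Real.fourierInv_eq_fourier_neg, neg_neg, Real.fourierInv_eq_fourier_comp_neg, he]

theorem integral_cutoffKernel {F : ℝ} (hF : F ∈ Set.Ioc (0 : ℝ) 1) :
    ∫ y, cutoffKernel hF y = 0 := by
  have h := congrFun (fourier_cutoffKernel hF) 0
  rw [Real.fourier_eq] at h
  simpa [cutoffSymbol] using h

theorem cutoffMass_mul_Lambda {F : ℝ} (hF : F ∈ Set.Ioc (0 : ℝ) 1)
    (f : 𝓢(EuclideanSpace ℝ (Fin 3), ℂ)) (x : EuclideanSpace ℝ (Fin 3)) :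
    cutoffMass * Lambda F f x = -∫ s in Set.Ioi (0 : ℝ), ((s ^ 2)⁻¹ : ℝ) *
      (2⁻¹ * ∫ y, cutoffKernel hF y * (f (x - s • y) + f (x + s • y) - 2 * f x)) := by
  set a : EuclideanSpace ℝ (Fin 3) → ℝ → ℝ := fun ξ s =>
    ξ 2 ^ 2 * lineCutoff (s ^ 2 * normFsq F ξ) with ha
  have hf' : ⇑(𝓕 f : 𝓢(EuclideanSpace ℝ (Fin 3), ℂ)) = 𝓕 (f : EuclideanSpace ℝ (Fin 3) → ℂ) := by rw [SchwartzMap.fourier_coe]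
  have hfm : Continuous (𝓕 (f : EuclideanSpace ℝ (Fin 3) → ℂ)) := hf' ▸ SchwartzMap.continuous _
  have hac : Continuous (Function.uncurry a) := by
    refine Continuous.mul (by fun_prop) (lineCutoff.continuous.comp ?_)
    unfold normFsq
    fun_prop
  have hFub : Integrable (Function.uncurry fun (ξ : EuclideanSpace ℝ (Fin 3)) (s : ℝ) =>
      (𝐞 (inner ℝ ξ x) : ℂ) * (a ξ s * 𝓕 (f : EuclideanSpace ℝ (Fin 3) → ℂ) ξ))
      (volume.prod (volume.restrict (Set.Ioi 0))) := by
    have hdom : Integrable (fun ξ : EuclideanSpace ℝ (Fin 3) =>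
        (‖ξ‖ ^ 2 + 2 / F ^ 2) * ‖𝓕 (f : EuclideanSpace ℝ (Fin 3) → ℂ) ξ‖) := by
      simp only [add_mul, ← hf']
      exact ((𝓕 f).integrable_pow_mul volume 2).add ((𝓕 f).integrable.norm.const_mul _)
    refine (hdom.mul_prod integrable_inv_one_add_sq.integrableOn).mono' ?_
      (Filter.Eventually.of_forall fun ⟨ξ, s⟩ => ?_)
    · refine Continuous.aestronglyMeasurable ?_
      refine Continuous.mul ?_ (Continuous.mul (Complex.continuous_ofReal.comp hac)
        (hfm.comp continuous_fst))
      exact continuous_induced_dom.comp (Real.continuous_fourierChar.comp (by fun_prop))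
    · have h0 : 0 ≤ a ξ s := mul_nonneg (sq_nonneg _) lineCutoff.nonneg
      simp only [Function.uncurry_apply_pair, norm_mul, Circle.norm_coe, one_mul,
        Complex.norm_real, Real.norm_of_nonneg h0]
      have := mul_le_mul_of_nonneg_right (cutoff_scale_le hF s ξ)
        (norm_nonneg (𝓕 (f : EuclideanSpace ℝ (Fin 3) → ℂ) ξ))
      linarith
  have hleft : cutoffMass * Lambda F f x = -∫ ξ, ∫ s in Set.Ioi (0 : ℝ),
      (𝐞 (inner ℝ ξ x) : ℂ) * (a ξ s * 𝓕 (f : EuclideanSpace ℝ (Fin 3) → ℂ) ξ) := by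
    rw [Lambda, Real.fourierInv_eq, ← integral_const_mul, ← integral_neg]
    congr 1 with ξ
    rw [integral_const_mul, integral_mul_const, integral_complex_ofReal, ha,
      integral_cutoff_scale hF, Circle.smul_def]
    push_cast
    simp only [smul_eq_mul]
    ring
  rw [hleft, integral_integral_swap hFub]
  congr 1
  refine setIntegral_congr_fun measurableSet_Ioi fun s hs => ?_
  have hs0 : (s : ℂ) ≠ 0 := Complex.ofReal_ne_zero.mpr (ne_of_gt hs)
  have hsym := SchwartzMap.integral_mul_comp_sub_eq_second_difference f (cutoffKernel hF)
    (cutoffKernel_neg hF) (integral_cutoffKernel hF) s x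
  rw [← hsym, ← SchwartzMap.fourierInv_fourier_smul_mul_fourier, fourier_cutoffKernel,
    Real.fourierInv_eq, ← integral_const_mul]
  congr 1 with ξ
  rw [cutoffSymbol, normFsq_smul, Circle.smul_def]
  simp only [ha, PiLp.smul_apply, smul_eq_mul]
  push_cast
  field_simp

theorem exists_enorm_Lambda_le {F : ℝ} (hF : F ∈ Set.Ioc (0 : ℝ) 1) :
    ∃ C > (0 : ℝ), ∀ (f : 𝓢(EuclideanSpace ℝ (Fin 3), ℂ)) (x : EuclideanSpace ℝ (Fin 3)),
      ‖Lambda F f x‖ₑ ≤ ENNReal.ofReal C * ∫⁻ y, ENNReal.ofReal (1 / ‖y‖ ^ 4) *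
        ‖f (x - y) + f (x + y) - 2 * f x‖ₑ := by
  obtain ⟨A, hA, hAb⟩ := (cutoffKernel hF).exists_lintegral_scale_le
  set g := cutoffKernel hF with hg
  have hm := cutoffMass_pos
  refine ⟨cutoffMass⁻¹ * A, by positivity, fun f x => ?_⟩
  set D : EuclideanSpace ℝ (Fin 3) → ℂ := fun y => f (x - y) + f (x + y) - 2 * f x with hD
  have hDc : Continuous D := by fun_prop
  have hgm : Continuous g := g.continuous
  have hgms : Measurable fun z : ℝ × EuclideanSpace ℝ (Fin 3) => g (z.1⁻¹ • z.2) :=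
    hgm.measurable.comp (by fun_prop)
  have hscale : ∀ s ∈ Set.Ioi (0 : ℝ), ‖(((s ^ 2)⁻¹ : ℝ) : ℂ) * (2⁻¹ * ∫ y, g y * D (s • y))‖ₑ ≤
      ∫⁻ z, ENNReal.ofReal ((s ^ 5)⁻¹) * ‖g (s⁻¹ • z)‖ₑ * ‖D z‖ₑ := fun s hs => by
    have hs0 : (0 : ℝ) < s := hs
    calc ‖(((s ^ 2)⁻¹ : ℝ) : ℂ) * (2⁻¹ * ∫ y, g y * D (s • y))‖ₑ
        = ENNReal.ofReal ((s ^ 2)⁻¹) * (‖(2⁻¹ : ℂ)‖ₑ * ‖∫ y, g y * D (s • y)‖ₑ) := by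
          rw [enorm_mul, enorm_mul, ← ofReal_norm (((s ^ 2)⁻¹ : ℝ) : ℂ), Complex.norm_real,
            Real.norm_of_nonneg (by positivity)]
      _ ≤ ENNReal.ofReal ((s ^ 2)⁻¹) * (1 * ∫⁻ y, ‖g y‖ₑ * ‖D (s • y)‖ₑ) := by
          gcongr
          · rw [← ofReal_norm, ENNReal.ofReal_le_one]
            norm_num
          · simpa only [enorm_mul] using
              enorm_integral_le_lintegral_enorm (fun y => g y * D (s • y))
      _ = ENNReal.ofReal ((s ^ 5)⁻¹) * ∫⁻ z, ‖g (s⁻¹ • z)‖ₑ * ‖D z‖ₑ := by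
          rw [one_mul, lintegral_mul_comp_smul volume hgm.enorm.measurable hDc.enorm.measurable hs0,
            ← mul_assoc, ← ENNReal.ofReal_mul (by positivity)]
          congr 2
          rw [finrank_euclideanSpace_fin]
          field_simp
      _ = _ := by
          rw [← lintegral_const_mul' _ _ ENNReal.ofReal_ne_top]
          simp only [mul_assoc]
  have hsplit : Lambda F f x = (cutoffMass⁻¹ : ℝ) * -∫ s in Set.Ioi (0 : ℝ), ((s ^ 2)⁻¹ : ℝ) *
      (2⁻¹ * ∫ y, g y * D (s • y)) := by
    rw [← cutoffMass_mul_Lambda hF f x, ← mul_assoc, ← Complex.ofReal_mul, inv_mul_cancel₀ hm.ne',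
      Complex.ofReal_one, one_mul]
  rw [hsplit, enorm_mul, enorm_neg, ENNReal.ofReal_mul (by positivity), mul_assoc,
    ← ofReal_norm ((cutoffMass⁻¹ : ℝ) : ℂ), Complex.norm_real, Real.norm_of_nonneg (by positivity)]
  gcongr
  calc ‖∫ s in Set.Ioi (0 : ℝ), (((s ^ 2)⁻¹ : ℝ) : ℂ) * (2⁻¹ * ∫ y, g y * D (s • y))‖ₑ
      ≤ ∫⁻ s in Set.Ioi (0 : ℝ), ‖(((s ^ 2)⁻¹ : ℝ) : ℂ) * (2⁻¹ * ∫ y, g y * D (s • y))‖ₑ :=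
        enorm_integral_le_lintegral_enorm _
    _ ≤ ∫⁻ s in Set.Ioi (0 : ℝ), ∫⁻ z, ENNReal.ofReal ((s ^ 5)⁻¹) * ‖g (s⁻¹ • z)‖ₑ * ‖D z‖ₑ :=
        setLIntegral_mono' measurableSet_Ioi hscale
    _ = ∫⁻ z, ∫⁻ s in Set.Ioi (0 : ℝ), ENNReal.ofReal ((s ^ 5)⁻¹) * ‖g (s⁻¹ • z)‖ₑ * ‖D z‖ₑ := by
        refine lintegral_lintegral_swap (Measurable.aemeasurable ?_)
        refine Measurable.mul (Measurable.mul (by fun_prop) hgms.enorm) ?_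
        exact hDc.enorm.measurable.comp measurable_snd
    _ ≤ ∫⁻ z, ENNReal.ofReal A * (ENNReal.ofReal (1 / ‖z‖ ^ 4) * ‖D z‖ₑ) := by
        refine lintegral_mono_ae ?_
        have hne : ∀ᵐ z : EuclideanSpace ℝ (Fin 3), z ≠ 0 := by simp [ae_iff]
        filter_upwards [hne] with z hz
        rw [lintegral_mul_const' _ _ enorm_ne_top, ← mul_assoc]
        gcongr
        exact hAb z hz
    _ = _ := lintegral_const_mul' _ _ ENNReal.ofReal_ne_top

/-- A continuous function is bounded everywhere by its essential supremum. -/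
theorem Continuous.enorm_le_eLpNorm_top {X G : Type*} [TopologicalSpace X] [MeasurableSpace X]
    {μ : Measure X} [μ.IsOpenPosMeasure] [NormedAddCommGroup G] {u : X → G} (hu : Continuous u)
    (x : X) : ‖u x‖ₑ ≤ eLpNorm u ∞ μ := by
  have hd : Dense {x | ‖u x‖ₑ ≤ eLpNorm u ∞ μ} := by
    refine Measure.dense_of_ae (μ := μ) ?_
    rw [eLpNorm_exponent_top]
    exact enorm_ae_le_eLpNormEssSup u μ
  have hc : IsClosed {x | ‖u x‖ₑ ≤ eLpNorm u ∞ μ} := isClosed_le hu.enorm continuous_const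
  have := hc.closure_eq ▸ hd.closure_eq
  exact (Set.ext_iff.mp this x).mpr trivial

/-- There is a constant `C_F > 0` depending only on `F` such that for every `p ∈ [1,∞]` and
every Schwartz `f`,
`‖Λf‖_{L^p} ≤ C_F ∫ |y|⁻⁴ ‖f(·−y) + f(·+y) − 2f‖_{L^p} dy` (a `Ḃ¹_{p,1}`-type bound). -/
theorem Lambda_Lp_Besov_bound
    (F : ℝ) (hF : F ∈ Set.Ioc (0 : ℝ) 1) :
    ∃ C > (0 : ℝ), ∀ p : ℝ≥0∞, 1 ≤ p →
      ∀ f : 𝓢(EuclideanSpace ℝ (Fin 3), ℂ),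
        eLpNorm (Lambda F ⇑f) p volume ≤
          ENNReal.ofReal C *
            ∫⁻ y : EuclideanSpace ℝ (Fin 3),
              ENNReal.ofReal (1 / ‖y‖ ^ 4) *
                eLpNorm (fun x => f (x - y) + f (x + y) - 2 * f x) p volume := by
  obtain ⟨C, hC, hbound⟩ := exists_enorm_Lambda_le hF
  refine ⟨C, hC, fun p hp f => ?_⟩
  have hcont : ∀ y, Continuous fun x => f (x - y) + f (x + y) - 2 * f x := fun y => by fun_prop
  rcases eq_or_ne p ∞ with rfl | hpt
  · rw [eLpNorm_exponent_top]
    refine eLpNormEssSup_le_of_ae_enorm_bound (Filter.Eventually.of_forall fun x => ?_)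
    refine (hbound f x).trans ?_
    gcongr with y
    exact (hcont y).enorm_le_eLpNorm_top x
  have hp0 : p ≠ 0 := (zero_lt_one.trans_le hp).ne'
  have hp1 : 1 ≤ p.toReal := by
    simpa using (ENNReal.toReal_le_toReal ENNReal.one_ne_top hpt).mpr hp
  have hpr : 0 < p.toReal := by linarith
  set h : EuclideanSpace ℝ (Fin 3) → EuclideanSpace ℝ (Fin 3) → ℝ≥0∞ := fun x y =>
    ENNReal.ofReal (1 / ‖y‖ ^ 4) * ‖f (x - y) + f (x + y) - 2 * f x‖ₑ with hh
  have hm : Measurable (Function.uncurry h) := by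
    refine Measurable.mul (by fun_prop) (Continuous.measurable (Continuous.enorm ?_))
    fun_prop
  have hroot : ∀ a : ℝ≥0∞, (a ^ p.toReal) ^ (1 / p.toReal) = a := fun a => by
    rw [← ENNReal.rpow_mul, mul_one_div_cancel hpr.ne', ENNReal.rpow_one]
  calc eLpNorm (Lambda F ⇑f) p volume
      = (∫⁻ x, ‖Lambda F f x‖ₑ ^ p.toReal) ^ (1 / p.toReal) :=
        eLpNorm_eq_lintegral_rpow_enorm_toReal hp0 hpt
    _ ≤ (∫⁻ x, (ENNReal.ofReal C * ∫⁻ y, h x y) ^ p.toReal) ^ (1 / p.toReal) := by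
        gcongr with x
        exact hbound f x
    _ = ENNReal.ofReal C * (∫⁻ x, (∫⁻ y, h x y) ^ p.toReal) ^ (1 / p.toReal) := by
        simp only [ENNReal.mul_rpow_of_nonneg _ _ hpr.le]
        rw [lintegral_const_mul' _ _ (by finiteness),
          ENNReal.mul_rpow_of_nonneg _ _ (by positivity), hroot]
    _ ≤ ENNReal.ofReal C * ∫⁻ y, (∫⁻ x, h x y ^ p.toReal) ^ (1 / p.toReal) := by
        gcongr
        exact lintegral_rpow_lintegral_le hp1 hm
    _ = _ := by
        congr 1
        refine lintegral_congr fun y => ?_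
        simp only [hh, ENNReal.mul_rpow_of_nonneg _ _ hpr.le]
        rw [lintegral_const_mul' _ _ (by finiteness),
          ENNReal.mul_rpow_of_nonneg _ _ (by positivity), hroot,
          eLpNorm_eq_lintegral_rpow_enorm_toReal hp0 hpt]
end
end
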